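/- arXiv:2501.05672 — 2 statements merged into one kernel-verified Lean document; each statement's English description precedes it below -/
import Mathlib

section
/- Define Ī(x, s) = x − (x − (s + ā)⁺)⁺. (i) If min(X, S) ≤ 0 ℙ-almost surely, then the zero contract is globally optimal: 𝔼[u(W(I))] ≤ 𝔼[u(w − X)] for every I ∈ 𝓐. (ii) If S ≥ 0 ℙ-almost surely and η = 0, then Ī is globally optimal: 𝔼[u(W(Ī))] ≥ 𝔼[u(W(I))] for every I ∈ 𝓐. -/
open MeasureTheory Set

noncomputable section

variable {Ω : Type*} [MeasurableSpace Ω]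

/-- Expected-value premium of an indemnity `I = I(x, s)`. -/
def premium (ℙ : Measure Ω) (η : ℝ) (X S : Ω → ℝ) (I : ℝ → ℝ → ℝ) : ℝ :=
  (1 + η) * ∫ ω, I (X ω) (S ω) ∂ℙ

/-- Buyer's terminal wealth under endogenous default with recovery ratio `τ`:
`W(I) = w − X − π(I) + 𝕀(I)` where `𝕀(I) = I·1_{I ≤ R} + τ·R·1_{I > R}` and
`R = (S + π(I))⁺`. -/
def wealth (ℙ : Measure Ω) (η τ w : ℝ) (X S : Ω → ℝ) (I : ℝ → ℝ → ℝ) (ω : Ω) : ℝ :=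
  w - X ω - premium ℙ η X S I +
    (if I (X ω) (S ω) ≤ max (S ω + premium ℙ η X S I) 0 then I (X ω) (S ω)
     else τ * max (S ω + premium ℙ η X S I) 0)

/-- Buyer's expected utility `𝔼[u(W(I))]`. -/
def EU (ℙ : Measure Ω) (η τ w : ℝ) (X S : Ω → ℝ) (u : ℝ → ℝ) (I : ℝ → ℝ → ℝ) : ℝ :=
  ∫ ω, u (wealth ℙ η τ w X S I ω) ∂ℙ

/-- Admissible indemnities `𝓐`: measurable and `0 ≤ I(x,s) ≤ x` on `[0, M] × ℝ`. -/
def Adm (M : ℝ) (I : ℝ → ℝ → ℝ) : Prop :=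
  Measurable (fun p : ℝ × ℝ => I p.1 p.2) ∧
    ∀ x ∈ Icc (0 : ℝ) M, ∀ s : ℝ, 0 ≤ I x s ∧ I x s ≤ x

/-- Full-insurance premium `π_f = (1+η)𝔼[X]`. -/
def piFull (ℙ : Measure Ω) (η : ℝ) (X : Ω → ℝ) : ℝ := (1 + η) * ∫ ω, X ω ∂ℙ

/-- `g(a) = (1+η)·𝔼[X − (X − (S+a)⁺)⁺] − a`. -/
def gfun (ℙ : Measure Ω) (η : ℝ) (X S : Ω → ℝ) (a : ℝ) : ℝ :=
  (1 + η) * ∫ ω, (X ω - max (X ω - max (S ω + a) 0) 0) ∂ℙ - a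

/-- `ā = inf {a ∈ [0, π_f] : g(a) ≤ 0}`. -/
def abar (ℙ : Measure Ω) (η : ℝ) (X S : Ω → ℝ) : ℝ :=
  sInf {a | a ∈ Icc 0 (piFull ℙ η X) ∧ gfun ℙ η X S a ≤ 0}

/-- The contract `Ī(x,s) = x − (x − (s + ā)⁺)⁺`. -/
def Ibar (ℙ : Measure Ω) (η : ℝ) (X S : Ω → ℝ) : ℝ → ℝ → ℝ :=
  fun x s => x - max (x - max (s + abar ℙ η X S) 0) 0

/-- A real random variable whose (real-valued) essential supremum is positive is a.e. bounded
by it: otherwise the essential supremum takes the default value `0`. -/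
lemma ae_le_of_essSup_eq_of_pos (ℙ : Measure Ω) [IsProbabilityMeasure ℙ] {X : Ω → ℝ}
    {M : ℝ} (hM : essSup X ℙ = M) (hM0 : 0 < M) :
    ∀ᵐ ω ∂ℙ, X ω ≤ M := by
  by_cases hb : Filter.IsBoundedUnder (· ≤ ·) (ae ℙ) X
  · rw [← hM]
    exact ae_le_essSup hb
  · exfalso
    have hempty : {a : ℝ | ∀ᵐ ω ∂ℙ, X ω ≤ a} = ∅ := by
      ext a
      simp only [mem_ofPred_eq, mem_empty_iff_false, iff_false]
      intro ha
      exact hb (Filter.isBoundedUnder_of_eventually_le ha)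
    have hzero : essSup X ℙ = 0 := by
      rw [essSup, Filter.limsup_eq, hempty, Real.sInf_empty]
    linarith

/-- A concave function lies below its tangents. -/
lemma le_tangent_of_deriv_antitone {u u' : ℝ → ℝ} (hu : ∀ x, HasDerivAt u (u' x) x)
    (hanti : Antitone u') (x y : ℝ) : u y ≤ u x + u' x * (y - x) := by
  have hcont : Continuous u := continuous_iff_continuousAt.2 fun z => (hu z).continuousAt
  rcases lt_trichotomy y x with h | h | h
  · obtain ⟨c, hc, hcs⟩ := exists_hasDerivAt_eq_slope u u' h hcont.continuousOn fun z _ => hu z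
    rw [eq_div_iff (by linarith)] at hcs
    nlinarith [hanti hc.2.le]
  · simp [h]
  · obtain ⟨c, hc, hcs⟩ := exists_hasDerivAt_eq_slope u u' h hcont.continuousOn fun z _ => hu z
    rw [eq_div_iff (by linarith)] at hcs
    nlinarith [hanti hc.1.le]

/-- Expectation of a terminal wealth with premium `c` and payment `J`. -/
lemma integral_sub_sub_add (ℙ : Measure Ω) [IsProbabilityMeasure ℙ] (w c : ℝ) {X J : Ω → ℝ}
    (hX : Integrable X ℙ) (hJ : Integrable J ℙ) :
    Integrable (fun ω => w - X ω - c + J ω) ℙ ∧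
      ∫ ω, (w - X ω - c + J ω) ∂ℙ = w - ∫ ω, X ω ∂ℙ - c + ∫ ω, J ω ∂ℙ := by
  have hwX : Integrable (fun ω => w - X ω) ℙ := (integrable_const w).sub hX
  have hwXc : Integrable (fun ω => w - X ω - c) ℙ := hwX.sub (integrable_const c)
  refine ⟨hwXc.add hJ, ?_⟩
  rw [integral_add hwXc hJ, integral_sub hwX (integrable_const c),
    integral_sub (integrable_const w) hX]
  simp

/-- The capped loss `x − (x − r⁺)⁺` is `min x r⁺`. -/
lemma sub_max_sub_eq_min (x r : ℝ) : x - max (x - max r 0) 0 = min x (max r 0) := by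
  rcases le_total x (max r 0) with h | h
  · rw [max_eq_right (by linarith), min_eq_left h, sub_zero]
  · rw [max_eq_left (by linarith), min_eq_right h, sub_sub_cancel]

/-- A monotone continuous function of an a.e. bounded measurable variable is integrable. -/
lemma integrable_comp_of_ae_mem_Icc (ℙ : Measure Ω) [IsProbabilityMeasure ℙ] {u : ℝ → ℝ}
    (hu : Continuous u) (hmono : Monotone u) {f : Ω → ℝ} (hf : Measurable f) (a b : ℝ)
    (h : ∀ᵐ ω ∂ℙ, f ω ∈ Icc a b) : Integrable (fun ω => u (f ω)) ℙ := by
  refine Integrable.of_mem_Icc (u a) (u b) (hu.measurable.comp hf).aemeasurable ?_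
  filter_upwards [h] with ω hω using ⟨hmono hω.1, hmono hω.2⟩

/-- The terminal wealth is a measurable random variable. -/
lemma measurable_wealth (ℙ : Measure Ω) (η τ w : ℝ) {X S : Ω → ℝ} (hX : Measurable X)
    (hS : Measurable S) {I : ℝ → ℝ → ℝ} (hI : Measurable (fun p : ℝ × ℝ => I p.1 p.2)) :
    Measurable (wealth ℙ η τ w X S I) := by
  have hIXS : Measurable fun ω => I (X ω) (S ω) := hI.comp (hX.prodMk hS)
  have hR : Measurable fun ω => max (S ω + premium ℙ η X S I) 0 :=
    (hS.add_const _).max measurable_const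
  exact ((measurable_const.sub hX).sub_const _).add
    (Measurable.ite (measurableSet_le hIXS hR) hIXS (hR.const_mul τ))

/-- The indemnity actually paid lies between `0` and both the promise and the reserve. -/
lemma actual_indemnity_bounds {i r τ : ℝ} (hi : 0 ≤ i) (hr : 0 ≤ r) (hτ : τ ∈ Icc (0 : ℝ) 1) :
    0 ≤ (if i ≤ r then i else τ * r) ∧ (if i ≤ r then i else τ * r) ≤ min i r := by
  split_ifs with h
  · exact ⟨hi, le_min le_rfl h⟩
  · have : τ * r ≤ r := mul_le_of_le_one_left hr hτ.2
    exact ⟨mul_nonneg hτ.1 hr, le_min (by linarith) this⟩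

/-- The terminal wealth of an indemnity with values in `[0, X]` is bounded when `X` is. -/
lemma wealth_mem_Icc (ℙ : Measure Ω) (η w : ℝ) {τ : ℝ} (hτ : τ ∈ Icc (0 : ℝ) 1) {X S : Ω → ℝ}
    {I : ℝ → ℝ → ℝ} {M : ℝ} {ω : Ω} (hXM : X ω ≤ M)
    (hI0 : 0 ≤ I (X ω) (S ω)) (hIX : I (X ω) (S ω) ≤ X ω) :
    wealth ℙ η τ w X S I ω ∈
      Icc (w - M - premium ℙ η X S I) (w - premium ℙ η X S I) := by
  obtain ⟨h0, h1⟩ := actual_indemnity_bounds (r := max (S ω + premium ℙ η X S I) 0) hI0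
    (le_max_right _ _) hτ
  have h2 := h1.trans (min_le_left _ _)
  constructor <;> simp only [wealth] <;> linarith

/-- `g` is continuous. -/
lemma continuous_gfun (ℙ : Measure Ω) (η : ℝ) {X S : Ω → ℝ} (hX : Measurable X)
    (hS : Measurable S) (hX0 : ∀ ω, 0 ≤ X ω) (hXi : Integrable X ℙ) :
    Continuous (gfun ℙ η X S) := by
  unfold gfun
  refine (continuous_const.mul (continuous_of_dominated (bound := X) ?_ ?_ hXi ?_)).sub
    continuous_id
  · intro a
    exact (hX.sub ((hX.sub ((hS.add_const a).max measurable_const)).max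
      measurable_const)).aestronglyMeasurable
  · intro a
    refine Filter.Eventually.of_forall fun ω => ?_
    rw [sub_max_sub_eq_min, Real.norm_of_nonneg (le_min (hX0 ω) (le_max_right _ _))]
    exact min_le_left _ _
  · exact Filter.Eventually.of_forall fun ω => by fun_prop

/-- The infimum defining `ā` is a zero of `g`. -/
lemma gfun_abar_eq_zero (ℙ : Measure Ω) {η : ℝ} (hη : 0 ≤ η) {X S : Ω → ℝ} (hX : Measurable X)
    (hS : Measurable S) (hX0 : ∀ ω, 0 ≤ X ω) (hXi : Integrable X ℙ) :
    gfun ℙ η X S (abar ℙ η X S) = 0 := by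
  have hcont := continuous_gfun ℙ η hX hS hX0 hXi
  set A := {a | a ∈ Icc 0 (piFull ℙ η X) ∧ gfun ℙ η X S a ≤ 0} with hA
  have hclosed : IsClosed A := isClosed_Icc.inter (isClosed_le hcont continuous_const)
  have hpi : 0 ≤ piFull ℙ η X := mul_nonneg (by linarith) (integral_nonneg hX0)
  have hbdd : BddBelow A := ⟨0, fun a ha => ha.1.1⟩
  have hne : A.Nonempty := by
    refine ⟨piFull ℙ η X, ⟨hpi, le_rfl⟩, sub_nonpos.2 ?_⟩
    refine mul_le_mul_of_nonneg_left (integral_mono_of_nonneg ?_ hXi ?_) (by linarith)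
    · refine Filter.Eventually.of_forall fun ω => ?_
      simp only [sub_max_sub_eq_min]
      exact le_min (hX0 ω) (le_max_right _ _)
    · exact Filter.Eventually.of_forall fun ω => sub_le_self _ (le_max_right _ _)
  have hmem : abar ℙ η X S ∈ A := hclosed.csInf_mem hne hbdd
  have hg0 : 0 ≤ gfun ℙ η X S 0 := by
    unfold gfun
    rw [sub_zero]
    refine mul_nonneg (by linarith) (integral_nonneg fun ω => ?_)
    simp only [sub_max_sub_eq_min]
    exact le_min (hX0 ω) (le_max_right _ _)
  obtain ⟨c, hc, hgc⟩ := intermediate_value_Icc' hmem.1.1 hcont.continuousOn ⟨hmem.2, hg0⟩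
  have hle : abar ℙ η X S ≤ c := csInf_le hbdd ⟨⟨hc.1, hc.2.trans hmem.1.2⟩, hgc.le⟩
  rw [le_antisymm hle hc.2, hgc]

/-- `Ī` is admissible. -/
lemma adm_Ibar (ℙ : Measure Ω) (η : ℝ) (X S : Ω → ℝ) (M : ℝ) : Adm M (Ibar ℙ η X S) := by
  constructor
  · unfold Ibar
    fun_prop
  · intro x hx s
    simp only [Ibar, sub_max_sub_eq_min]
    exact ⟨le_min hx.1 (le_max_right _ _), min_le_left _ _⟩

/-- The premium of `Ī` is `ā`. -/
lemma premium_Ibar (ℙ : Measure Ω) {η : ℝ} (hη : 0 ≤ η) {X S : Ω → ℝ} (hX : Measurable X)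
    (hS : Measurable S) (hX0 : ∀ ω, 0 ≤ X ω) (hXi : Integrable X ℙ) :
    premium ℙ η X S (Ibar ℙ η X S) = abar ℙ η X S :=
  sub_eq_zero.1 (gfun_abar_eq_zero ℙ hη hX hS hX0 hXi)

/-- `Ī` never triggers default. -/
lemma wealth_Ibar (ℙ : Measure Ω) {η : ℝ} (τ w : ℝ) (hη : 0 ≤ η) {X S : Ω → ℝ}
    (hX : Measurable X) (hS : Measurable S) (hX0 : ∀ ω, 0 ≤ X ω) (hXi : Integrable X ℙ) (ω : Ω) :
    wealth ℙ η τ w X S (Ibar ℙ η X S) ω =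
      w - X ω - abar ℙ η X S + min (X ω) (max (S ω + abar ℙ η X S) 0) := by
  rw [wealth, premium_Ibar ℙ hη hX hS hX0 hXi]
  simp only [Ibar, sub_max_sub_eq_min]
  rw [if_pos (min_le_right _ _)]

/-- (i) if `min(X,S) ≤ 0` a.s. then the zero contract is globally optimal;
(ii) if `S ≥ 0` a.s. and `η = 0` then `Ī` is globally optimal. -/
theorem stmt5
    (ℙ : Measure Ω) [IsProbabilityMeasure ℙ]
    (X S : Ω → ℝ) (hXm : Measurable X) (hSm : Measurable S)
    (hX0 : ∀ ω, 0 ≤ X ω) (M : ℝ) (hM : essSup X ℙ = M) (hM0 : 0 < M)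
    (η : ℝ) (hη : 0 ≤ η) (τ : ℝ) (hτ : τ ∈ Icc (0 : ℝ) 1) (w : ℝ)
    (u u' u'' : ℝ → ℝ)
    (hu' : ∀ x, HasDerivAt u (u' x) x) (hu'' : ∀ x, HasDerivAt u' (u'' x) x)
    (hu'pos : ∀ x, 0 < u' x) (hu''neg : ∀ x, u'' x < 0) :
    ((∀ᵐ ω ∂ℙ, min (X ω) (S ω) ≤ 0) →
      ∀ I : ℝ → ℝ → ℝ, Adm M I →
        EU ℙ η τ w X S u I ≤ ∫ ω, u (w - X ω) ∂ℙ) ∧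
    ((∀ᵐ ω ∂ℙ, 0 ≤ S ω) → η = 0 →
      ∀ I : ℝ → ℝ → ℝ, Adm M I →
        EU ℙ η τ w X S u I ≤ EU ℙ η τ w X S u (Ibar ℙ η X S)) := by
  have hXM := ae_le_of_essSup_eq_of_pos ℙ hM hM0
  have hXi : Integrable X ℙ := Integrable.of_mem_Icc 0 M hXm.aemeasurable
    (hXM.mono fun ω h => ⟨hX0 ω, h⟩)
  have hcont : Continuous u := continuous_iff_continuousAt.2 fun x => (hu' x).continuousAt
  have hmono : Monotone u := (strictMono_of_hasDerivAt_pos hu' hu'pos).monotone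
  have hanti : Antitone u' := (strictAnti_of_hasDerivAt_neg hu'' hu''neg).antitone
  have hIae : ∀ I : ℝ → ℝ → ℝ, Adm M I →
      ∀ᵐ ω ∂ℙ, 0 ≤ I (X ω) (S ω) ∧ I (X ω) (S ω) ≤ X ω := fun I hI =>
    hXM.mono fun ω h => hI.2 _ ⟨hX0 ω, h⟩ _
  have hWae : ∀ I : ℝ → ℝ → ℝ, Adm M I → ∀ᵐ ω ∂ℙ, wealth ℙ η τ w X S I ω ∈
      Icc (w - M - premium ℙ η X S I) (w - premium ℙ η X S I) := by
    intro I hI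
    filter_upwards [hXM, hIae I hI] with ω h1 h2
    exact wealth_mem_Icc ℙ η w hτ h1 h2.1 h2.2
  have hWm : ∀ I : ℝ → ℝ → ℝ, Adm M I → Measurable (wealth ℙ η τ w X S I) := fun I hI =>
    measurable_wealth ℙ η τ w hXm hSm hI.1
  have hUi : ∀ I : ℝ → ℝ → ℝ, Adm M I →
      Integrable (fun ω => u (wealth ℙ η τ w X S I ω)) ℙ := fun I hI =>
    integrable_comp_of_ae_mem_Icc ℙ hcont hmono (hWm I hI) _ _ (hWae I hI)
  constructor
  · intro hmin I hI
    have hπ : 0 ≤ premium ℙ η X S I := mul_nonneg (by linarith)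
      (integral_nonneg_of_ae ((hIae I hI).mono fun ω h => h.1))
    refine integral_mono_ae (hUi I hI) (integrable_comp_of_ae_mem_Icc ℙ hcont hmono
      (measurable_const.sub hXm) (w - M) w ?_) ?_
    · filter_upwards [hXM] with ω h
      exact ⟨by linarith, by linarith [hX0 ω]⟩
    · filter_upwards [hmin, hIae I hI] with ω hm h
      apply hmono
      have hb := (actual_indemnity_bounds h.1
        (le_max_right (S ω + premium ℙ η X S I) 0) hτ).2
      have hpay := hb.trans (min_le_left _ _)
      have hres := hb.trans (min_le_right _ _)
      simp only [wealth]
      rcases min_le_iff.1 hm with hx | hs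
      · linarith [hX0 ω]
      · have : max (S ω + premium ℙ η X S I) 0 ≤ premium ℙ η X S I :=
          max_le (by linarith) hπ
        linarith
  · intro hS0 hη0 I hI
    subst hη0
    have hadm := adm_Ibar ℙ 0 X S M
    set a := abar ℙ 0 X S
    set V := wealth ℙ 0 τ w X S (Ibar ℙ 0 X S)
    set W := wealth ℙ 0 τ w X S I with hW
    set π := premium ℙ 0 X S I with hπdef
    have ha0 : 0 ≤ a := Real.sInf_nonneg fun b hb => hb.1.1
    have hπ : 0 ≤ π := mul_nonneg (by linarith)
      (integral_nonneg_of_ae ((hIae I hI).mono fun ω h => h.1))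
    have hVeq : ∀ ω, V ω = w - X ω - a + min (X ω) (max (S ω + a) 0) :=
      wealth_Ibar ℙ τ w hη hXm hSm hX0 hXi
    have hWi : Integrable W ℙ :=
      Integrable.of_mem_Icc _ _ (hWm I hI).aemeasurable (hWae I hI)
    have hVi : Integrable V ℙ :=
      Integrable.of_mem_Icc _ _ (hWm _ hadm).aemeasurable (hWae _ hadm)
    have hIi : Integrable (fun ω => I (X ω) (S ω)) ℙ :=
      Integrable.of_mem_Icc 0 M (hI.1.comp (hXm.prodMk hSm)).aemeasurable (by
        filter_upwards [hXM, hIae I hI] with ω h1 h2 using ⟨h2.1, h2.2.trans h1⟩)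
    have hWmean : ∫ ω, W ω ∂ℙ ≤ w - ∫ ω, X ω ∂ℙ := by
      have hle : ∫ ω, W ω ∂ℙ ≤ ∫ ω, (w - X ω - π + I (X ω) (S ω)) ∂ℙ := by
        refine integral_mono_ae hWi (integral_sub_sub_add ℙ w π hXi hIi).1 ?_
        filter_upwards [hIae I hI] with ω h
        exact add_le_add_right ((actual_indemnity_bounds h.1 (le_max_right _ _) hτ).2.trans
          (min_le_left _ _)) _
      have hprem : π = ∫ ω, I (X ω) (S ω) ∂ℙ := by
        rw [hπdef, premium, add_zero, one_mul]
      rw [(integral_sub_sub_add ℙ w π hXi hIi).2] at hle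
      linarith
    have hVmean : ∫ ω, V ω ∂ℙ = w - ∫ ω, X ω ∂ℙ := by
      have hg : gfun ℙ 0 X S a = 0 := gfun_abar_eq_zero ℙ hη hXm hSm hX0 hXi
      simp only [gfun, add_zero, one_mul, sub_max_sub_eq_min] at hg
      have hcap : Integrable (fun ω => min (X ω) (max (S ω + a) 0)) ℙ :=
        Integrable.of_mem_Icc 0 M (by fun_prop) (by
          filter_upwards [hXM] with ω h
          exact ⟨le_min (hX0 ω) (le_max_right _ _), (min_le_left _ _).trans h⟩)
      simp only [hVeq]
      rw [(integral_sub_sub_add ℙ w a hXi hcap).2]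
      linarith
    have hpoint : ∀ᵐ ω ∂ℙ, u (W ω) ≤ u (V ω) + u' (w - a) * (W ω - V ω) := by
      filter_upwards [hS0, hIae I hI] with ω hs h
      refine (le_tangent_of_deriv_antitone hu' hanti (V ω) (W ω)).trans
        (add_le_add_right ?_ _)
      have hcapV : max (S ω + a) 0 = S ω + a := max_eq_left (by linarith)
      have hv := hVeq ω
      rw [hcapV] at hv
      rcases le_total (X ω) (S ω + a) with hx | hx
      · rw [min_eq_left hx] at hv
        rw [show V ω = w - a by linarith]
      · rw [min_eq_right hx] at hv
        have hWle : W ω ≤ V ω := by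
          have hb := (actual_indemnity_bounds h.1 (le_max_right (S ω + π) 0) hτ).2.trans
            (min_le_right _ _)
          have hcapW : max (S ω + π) 0 = S ω + π := max_eq_left (by linarith)
          simp only [hW, wealth]
          rw [← hπdef]
          linarith
        exact mul_le_mul_of_nonpos_right (hanti (by linarith)) (by linarith)
    have hVu : Integrable (fun ω => u (V ω)) ℙ := hUi _ hadm
    have hdiff : Integrable (fun ω => u' (w - a) * (W ω - V ω)) ℙ := (hWi.sub hVi).const_mul _
    have hfin : ∫ ω, u (W ω) ∂ℙ ≤ ∫ ω, (u (V ω) + u' (w - a) * (W ω - V ω)) ∂ℙ :=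
      integral_mono_ae (hUi I hI) (hVu.add hdiff) hpoint
    rw [integral_add hVu hdiff, integral_const_mul, integral_sub hWi hVi] at hfin
    have : u' (w - a) * (∫ ω, W ω ∂ℙ - ∫ ω, V ω ∂ℙ) ≤ 0 :=
      mul_nonpos_of_nonneg_of_nonpos (hu'pos _).le (by linarith)
    change ∫ ω, u (W ω) ∂ℙ ≤ ∫ ω, u (V ω) ∂ℙ
    linarith
end
end

section
/- Let S₁ and S₂ be background risks with S₁ ≤ S₂ ℙ-almost surely, such that (X, S₁) and (X, S₂) each satisfy Assumption A, and suppose η > 0. Let (a₁*, d₁*) and (a₂*, d₂*) denote the corresponding optimal premium–deductible pairs. Then a₁* ≤ a₂* and a₁* + d₁* ≤ a₂* + d₂*. If moreover the Arrow–Pratt coefficient −u″/u′ is a nonincreasing function (DARA), then d₁* ≥ d₂*. -/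
open MeasureTheory Set

noncomputable section

variable {Ω : Type*} [MeasurableSpace Ω]
/-- Distribution function of a random variable. -/
def distFn (ℙ : Measure Ω) (Y : Ω → ℝ) (t : ℝ) : ℝ := (ℙ {ω | Y ω ≤ t}).toReal

/-- The set of discontinuity points in `[0, M]` of the distribution function of `Y`. -/
def JumpSet (ℙ : Measure Ω) (Y : Ω → ℝ) (M : ℝ) : Set ℝ :=
  {x ∈ Icc (0 : ℝ) M | ¬ ContinuousAt (distFn ℙ Y) x}

/-- Assumption A: (1) `S ≥ 0` a.s.; (2) the distribution functions of `X` and of `X − S`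
have finitely many discontinuity points in `[0, M]`; (3) the distribution function of `X`
is strictly increasing on `[0, M]`; (4) `𝔼[(X − y)⁺ − (X − y − S)⁺] > 0` for `y ∈ [0, M)`. -/
def AssumpA (ℙ : Measure Ω) (X S : Ω → ℝ) (M : ℝ) : Prop :=
  (∀ᵐ ω ∂ℙ, 0 ≤ S ω) ∧
  (JumpSet ℙ X M).Finite ∧
  (JumpSet ℙ (fun ω => X ω - S ω) M).Finite ∧
  StrictMonoOn (distFn ℙ X) (Icc 0 M) ∧
  ∀ y ∈ Ico (0 : ℝ) M, 0 < ∫ ω, (max (X ω - y) 0 - max (X ω - y - S ω) 0) ∂ℙ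

/-- `g_a(y) = (1+η)·𝔼[(X − y)⁺ − (X − y − (S+a))⁺] − a`. -/
def gA (ℙ : Measure Ω) (η : ℝ) (X S : Ω → ℝ) (a y : ℝ) : ℝ :=
  (1 + η) * ∫ ω, (max (X ω - y) 0 - max (X ω - y - (S ω + a)) 0) ∂ℙ - a

/-- The threshold `u′(w − M)/𝔼[u′(w − X)] − 1` for the premium loading. -/
def thr (ℙ : Measure Ω) (X : Ω → ℝ) (u' : ℝ → ℝ) (w M : ℝ) : ℝ :=
  u' (w - M) / (∫ ω, u' (w - X ω) ∂ℙ) - 1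

/-- `dfun` is the deductible map `a ↦ d(a)`: for each `a ∈ [0, ā]`, `d(a)` is the
(unique) zero of `g_a` in `[0, M]`. -/
def DFun (ℙ : Measure Ω) (η : ℝ) (X S : Ω → ℝ) (M : ℝ) (dfun : ℝ → ℝ) : Prop :=
  ∀ a ∈ Icc 0 (abar ℙ η X S), dfun a ∈ Icc (0 : ℝ) M ∧ gA ℙ η X S a (dfun a) = 0

/-- `(astar, dstar)` is the optimal premium–deductible pair: `(0, M)` if
`η ≥ u′(w−M)/𝔼[u′(w−X)] − 1`; otherwise `astar ∈ (0, ā)` is the unique solution of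
`𝔼[u′(w − min(X, d(a)) − a)] = u′(w − d(a) − a)/(1+η)` and `dstar = d(astar)`. -/
def OptPair (ℙ : Measure Ω) (η : ℝ) (X S : Ω → ℝ) (u' : ℝ → ℝ) (w M : ℝ)
    (dfun : ℝ → ℝ) (astar dstar : ℝ) : Prop :=
  (thr ℙ X u' w M ≤ η → astar = 0 ∧ dstar = M) ∧
  (η < thr ℙ X u' w M →
    astar ∈ Ioo 0 (abar ℙ η X S) ∧
    (∫ ω, u' (w - min (X ω) (dfun astar) - astar) ∂ℙ)
      = u' (w - dfun astar - astar) / (1 + η) ∧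
    dstar = dfun astar)

/-- Strict monotonicity of the integral when the inequality is strict on a non-null set. -/
lemma integral_lt_integral_of_le_of_measure_lt_ne_zero {μ : Measure Ω} {f g : Ω → ℝ}
    (hf : Integrable f μ) (hg : Integrable g μ) (hle : ∀ ω, f ω ≤ g ω)
    (hlt : μ {ω | f ω < g ω} ≠ 0) : ∫ ω, f ω ∂μ < ∫ ω, g ω ∂μ := by
  rw [← sub_pos, ← integral_sub hg hf,
    integral_pos_iff_support_of_nonneg (fun ω => sub_nonneg.mpr (hle ω)) (hg.sub hf)]
  exact pos_iff_ne_zero.mpr (mt (measure_mono_null fun ω hω => (sub_pos.mpr hω.out).ne') hlt)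

/-- A real random variable with positive essential supremum is essentially bounded by it. -/
lemma ae_le_of_essSup_pos (ℙ : Measure Ω) (X : Ω → ℝ) {M : ℝ} (hM : essSup X ℙ = M)
    (hM0 : 0 < M) : ∀ᵐ ω ∂ℙ, X ω ≤ M := by
  have hb : Filter.IsBoundedUnder (· ≤ ·) (ae ℙ) X := by
    by_contra hb
    have hempty : {a : ℝ | ∀ᶠ n in Filter.map X (ae ℙ), n ≤ a} = ∅ := by
      ext a
      simp only [mem_ofPred_eq, mem_empty_iff_false, iff_false]
      exact fun ha => hb ⟨a, ha⟩
    have : essSup X ℙ = 0 := by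
      rw [essSup, Filter.limsup, Filter.limsSup, hempty, Real.sInf_empty]
    linarith
  rw [← hM]
  exact ae_le_essSup hb

/-- A positive, antitone marginal utility is integrable along the retained-loss payoff. -/
lemma integrable_marginal (ℙ : Measure Ω) [IsProbabilityMeasure ℙ] {X : Ω → ℝ}
    (hXm : Measurable X) {v : ℝ → ℝ} (hv : Antitone v) (hpos : ∀ x, 0 < v x) (t d : ℝ) :
    Integrable (fun ω => v (t + max (d - X ω) 0)) ℙ := by
  refine Integrable.of_bound (C := v t) ?_ ?_
  · exact (hv.measurable.comp (by fun_prop)).aestronglyMeasurable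
  · refine Filter.Eventually.of_forall fun ω => ?_
    rw [Real.norm_of_nonneg (hpos _).le]
    exact hv (by linarith [le_max_right (d - X ω) 0])

/-- At fixed worst-case wealth, expected marginal utility strictly decreases in the deductible. -/
lemma integral_marginal_lt (ℙ : Measure Ω) [IsProbabilityMeasure ℙ] {X : Ω → ℝ}
    (hXm : Measurable X) {v : ℝ → ℝ} (hv : StrictAnti v) (hpos : ∀ x, 0 < v x) (t : ℝ)
    {d d' : ℝ} (hdd : d < d') (hP : 0 < ℙ {ω | X ω < d'}) :
    ∫ ω, v (t + max (d' - X ω) 0) ∂ℙ < ∫ ω, v (t + max (d - X ω) 0) ∂ℙ := by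
  refine integral_lt_integral_of_le_of_measure_lt_ne_zero
    (integrable_marginal ℙ hXm hv.antitone hpos t d')
    (integrable_marginal ℙ hXm hv.antitone hpos t d)
    (fun ω => hv.antitone (by gcongr)) ?_
  refine (hP.trans_le (measure_mono fun ω hω => hv ?_)).ne'
  have : X ω < d' := hω
  gcongr
  rw [max_eq_left (by linarith : 0 ≤ d' - X ω)]
  exact max_lt (by linarith) (by linarith)

/-- At fixed premium, raising the deductible raises expected marginal utility by at most the
exceedance probability times the increase in the largest marginal utility. -/
lemma integral_marginal_le_add (ℙ : Measure Ω) [IsProbabilityMeasure ℙ] {X : Ω → ℝ}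
    (hXm : Measurable X) {v : ℝ → ℝ} (hv : Antitone v) (hpos : ∀ x, 0 < v x) (s : ℝ)
    {d d' : ℝ} (hdd : d ≤ d') :
    ∫ ω, v (s - d' + max (d' - X ω) 0) ∂ℙ ≤
      ∫ ω, v (s - d + max (d - X ω) 0) ∂ℙ
        + ℙ.real {ω | d < X ω} * (v (s - d') - v (s - d)) := by
  have hms : MeasurableSet {ω | d < X ω} := measurableSet_lt measurable_const hXm
  have hi := integrable_marginal ℙ hXm hv hpos (s - d) d
  have hind : Integrable ({ω | d < X ω}.indicator fun _ => v (s - d') - v (s - d)) ℙ :=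
    (integrable_const _).indicator hms
  rw [← smul_eq_mul, ← integral_indicator_const _ hms, ← integral_add hi hind]
  refine integral_mono (integrable_marginal ℙ hXm hv hpos _ _) (hi.add hind) fun ω => ?_
  by_cases h : d < X ω
  · have h2 : max (d - X ω) 0 = 0 := max_eq_right (by linarith)
    simp only [indicator, mem_ofPred_eq, h, if_true, h2, add_zero]
    have := hv (by linarith [le_max_right (d' - X ω) 0] : s - d' ≤ s - d' + max (d' - X ω) 0)
    linarith
  · push Not at h
    simp only [indicator, mem_ofPred_eq, not_lt.mpr h, if_false, add_zero]
    rw [max_eq_left (by linarith), max_eq_left (by linarith)]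
    exact le_of_eq (by congr 1; ring)

/-- The first-order condition forces the exceedance probability below `1 / (1 + η)`. -/
lemma exceedance_lt_of_firstOrder (ℙ : Measure Ω) [IsProbabilityMeasure ℙ] {X : Ω → ℝ}
    (hXm : Measurable X) {v : ℝ → ℝ} (hv : Antitone v) (hpos : ∀ x, 0 < v x) {η t d : ℝ}
    (hη : 0 < η) (hP : 0 < ℙ {ω | X ω < d})
    (hF : (1 + η) * ∫ ω, v (t + max (d - X ω) 0) ∂ℙ = v t) :
    (1 + η) * ℙ.real {ω | d < X ω} < 1 := by
  have hms : MeasurableSet {ω | d < X ω} := measurableSet_lt measurable_const hXm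
  have hlt : ℙ.real {ω | d < X ω} * v t < ∫ ω, v (t + max (d - X ω) 0) ∂ℙ := by
    rw [← smul_eq_mul, ← integral_indicator_const _ hms]
    refine integral_lt_integral_of_le_of_measure_lt_ne_zero
      ((integrable_const _).indicator hms) (integrable_marginal ℙ hXm hv hpos t d)
      (fun ω => ?_) ?_
    · by_cases h : d < X ω
      · have h2 : max (d - X ω) 0 = 0 := max_eq_right (by linarith)
        simp [indicator, h, h2]
      · simpa [indicator, h] using (hpos _).le
    · refine (hP.trans_le (measure_mono fun ω hω => ?_)).ne'
      have : X ω < d := hω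
      simpa [indicator, not_lt.mpr this.le] using hpos _
  have := mul_lt_mul_of_pos_left hlt (by linarith : 0 < 1 + η)
  rw [hF, ← mul_assoc] at this
  exact lt_of_mul_lt_mul_right (by linarith) (hpos t).le

/-- Single crossing of the first-order condition in the deductible at fixed premium. -/
lemma firstOrder_lt_of_lt (ℙ : Measure Ω) [IsProbabilityMeasure ℙ] {X : Ω → ℝ}
    (hXm : Measurable X) {v : ℝ → ℝ} (hv : StrictAnti v) (hpos : ∀ x, 0 < v x) {η s d d' : ℝ}
    (hη : 0 < η) (hP : 0 < ℙ {ω | X ω < d})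
    (hF : (1 + η) * ∫ ω, v (s - d + max (d - X ω) 0) ∂ℙ = v (s - d)) (hdd : d < d') :
    (1 + η) * ∫ ω, v (s - d' + max (d' - X ω) 0) ∂ℙ < v (s - d') := by
  have hp := exceedance_lt_of_firstOrder ℙ hXm hv.antitone hpos hη hP hF
  have h := mul_le_mul_of_nonneg_left
    (integral_marginal_le_add ℙ hXm hv.antitone hpos s hdd.le) (by linarith : 0 ≤ 1 + η)
  have hΔ : 0 < v (s - d') - v (s - d) := sub_pos.mpr (hv (by linarith))
  have := mul_lt_mul_of_pos_right hp hΔ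
  rw [mul_add, hF, ← mul_assoc] at h
  linarith

/-- The solution set of the first-order condition is increasing in (premium, worst-case loss). -/
lemma firstOrder_add_lt_of_lt (ℙ : Measure Ω) [IsProbabilityMeasure ℙ] {X : Ω → ℝ}
    (hXm : Measurable X) {v : ℝ → ℝ} (hv : StrictAnti v) (hpos : ∀ x, 0 < v x)
    {η w a d a' d' : ℝ} (hη : 0 < η) (hP : 0 < ℙ {ω | X ω < d}) (hP' : 0 < ℙ {ω | X ω < d'})
    (hF : (1 + η) * ∫ ω, v (w - a - d + max (d - X ω) 0) ∂ℙ = v (w - a - d))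
    (hF' : (1 + η) * ∫ ω, v (w - a' - d' + max (d' - X ω) 0) ∂ℙ = v (w - a' - d'))
    (haa : a < a') : a + d < a' + d' := by
  by_contra! hc
  have h1 := integral_marginal_lt ℙ hXm hv hpos (w - a - d)
    (by linarith : a + d - a' < d) hP
  have h2 := mul_lt_mul_of_pos_left h1 (by linarith : 0 < 1 + η)
  have e : w - a - d = w - a' - (a + d - a') := by ring
  rw [hF, e] at h2
  rcases hc.eq_or_lt with hc | hc
  · have : a + d - a' = d' := by linarith
    rw [this, hF'] at h2
    exact h2.false
  · exact lt_asymm h2 (firstOrder_lt_of_lt ℙ hXm hv hpos hη hP' hF' (by linarith))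

/-- The ceded loss is integrable. -/
lemma integrable_ceded (ℙ : Measure Ω) [IsProbabilityMeasure ℙ] {X S : Ω → ℝ}
    (hXm : Measurable X) (hSm : Measurable S) (hX0 : ∀ ω, 0 ≤ X ω) {M : ℝ}
    (hXM : ∀ᵐ ω ∂ℙ, X ω ≤ M) (hS : ∀ᵐ ω ∂ℙ, 0 ≤ S ω) {a : ℝ} (ha : 0 ≤ a) (y : ℝ) :
    Integrable (fun ω => max (X ω - y) 0 - max (X ω - y - (S ω + a)) 0) ℙ := by
  refine Integrable.of_bound (C := M + |y|) ?_ ?_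
  · exact Measurable.aestronglyMeasurable (by fun_prop)
  · filter_upwards [hXM, hS] with ω h1 h2
    have h3 : max (X ω - y - (S ω + a)) 0 ≤ max (X ω - y) 0 :=
      max_le_max (by linarith) le_rfl
    have h4 : max (X ω - y) 0 ≤ M + |y| :=
      max_le (by linarith [neg_abs_le y]) (by linarith [hX0 ω, abs_nonneg y])
    rw [Real.norm_of_nonneg (by linarith)]
    linarith [le_max_right (X ω - y - (S ω + a)) 0]

/-- `g_a(y)` is monotone in the background risk. -/
lemma gA_mono_risk (ℙ : Measure Ω) [IsProbabilityMeasure ℙ] {X S₁ S₂ : Ω → ℝ}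
    (hXm : Measurable X) (hS₁m : Measurable S₁) (hS₂m : Measurable S₂)
    (hX0 : ∀ ω, 0 ≤ X ω) {M : ℝ} (hXM : ∀ᵐ ω ∂ℙ, X ω ≤ M) (hS₁ : ∀ᵐ ω ∂ℙ, 0 ≤ S₁ ω)
    (hS₂ : ∀ᵐ ω ∂ℙ, 0 ≤ S₂ ω) (hS12 : ∀ᵐ ω ∂ℙ, S₁ ω ≤ S₂ ω) {η a : ℝ} (hη : 0 < η)
    (ha : 0 ≤ a) (y : ℝ) : gA ℙ η X S₁ a y ≤ gA ℙ η X S₂ a y := by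
  unfold gA
  gcongr (1 + η) * ?_ - a
  refine integral_mono_ae (integrable_ceded ℙ hXm hS₁m hX0 hXM hS₁ ha y)
    (integrable_ceded ℙ hXm hS₂m hX0 hXM hS₂ ha y) ?_
  filter_upwards [hS12] with ω h
  gcongr

/-- `g_a(y)` strictly decreases when the premium rises, `a + y` does not fall, and the
exceedance probability at the new deductible is below `1 / (1 + η)`. -/
lemma gA_lt_of_lt (ℙ : Measure Ω) [IsProbabilityMeasure ℙ] {X S : Ω → ℝ}
    (hXm : Measurable X) (hSm : Measurable S) (hX0 : ∀ ω, 0 ≤ X ω) {M : ℝ}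
    (hXM : ∀ᵐ ω ∂ℙ, X ω ≤ M) (hS : ∀ᵐ ω ∂ℙ, 0 ≤ S ω) {η a a' y y' : ℝ} (hη : 0 < η)
    (ha : 0 ≤ a) (haa : a < a') (hyy : a + y ≤ a' + y')
    (hp : (1 + η) * ℙ.real {ω | y' < X ω} < 1) :
    gA ℙ η X S a' y' < gA ℙ η X S a y := by
  have hms : MeasurableSet {ω | y' < X ω} := measurableSet_lt measurable_const hXm
  have hi := integrable_ceded ℙ hXm hSm hX0 hXM hS ha y
  have hind : Integrable ({ω | y' < X ω}.indicator fun _ => a' - a) ℙ :=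
    (integrable_const _).indicator hms
  have hle : ∫ ω, (max (X ω - y') 0 - max (X ω - y' - (S ω + a')) 0) ∂ℙ ≤
      ∫ ω, (max (X ω - y) 0 - max (X ω - y - (S ω + a)) 0) ∂ℙ
        + ℙ.real {ω | y' < X ω} * (a' - a) := by
    rw [← smul_eq_mul, ← integral_indicator_const _ hms, ← integral_add hi hind]
    refine integral_mono_ae (integrable_ceded ℙ hXm hSm hX0 hXM hS (ha.trans haa.le) y')
      (hi.add hind) ?_
    filter_upwards [hS] with ω h
    simp only [indicator, mem_ofPred_eq]
    grind
  have h1 := mul_le_mul_of_nonneg_left hle (by linarith : 0 ≤ 1 + η)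
  have h2 := mul_lt_mul_of_pos_right hp (sub_pos.mpr haa)
  unfold gA
  rw [mul_add, ← mul_assoc] at h1
  linarith

/-- Under decreasing absolute risk aversion, `t ↦ u′(t + h) / u′(t)` is monotone for `h ≥ 0`. -/
lemma monotone_marginal_ratio {v v' : ℝ → ℝ} (hv : ∀ x, HasDerivAt v (v' x) x)
    (hpos : ∀ x, 0 < v x) (hA : Antitone fun x => -v' x / v x) {h : ℝ} (hh : 0 ≤ h) :
    Monotone fun t => v (t + h) / v t := by
  have hd : ∀ t, HasDerivAt (fun t => v (t + h) / v t)
      ((v' (t + h) * v t - v (t + h) * v' t) / v t ^ 2) t := fun t =>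
    ((hv (t + h)).comp_add_const t h).div (hv t) (hpos t).ne'
  refine monotone_of_deriv_nonneg (fun t => (hd t).differentiableAt) fun t => ?_
  rw [(hd t).deriv]
  have := hA (by linarith : t ≤ t + h)
  simp only [] at this
  rw [div_le_div_iff₀ (hpos _) (hpos _)] at this
  exact div_nonneg (by linarith) (sq_nonneg _)

/-- Under decreasing absolute risk aversion, a lower worst-case wealth lowers the ratio of
expected marginal utility to worst-case marginal utility. -/
lemma integral_marginal_mul_le (ℙ : Measure Ω) [IsProbabilityMeasure ℙ] {X : Ω → ℝ}
    (hXm : Measurable X) {v v' : ℝ → ℝ} (hv : ∀ x, HasDerivAt v (v' x) x) (hanti : Antitone v)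
    (hpos : ∀ x, 0 < v x) (hA : Antitone fun x => -v' x / v x) {t t' : ℝ} (htt : t ≤ t')
    (d : ℝ) :
    (∫ ω, v (t + max (d - X ω) 0) ∂ℙ) * v t' ≤ (∫ ω, v (t' + max (d - X ω) 0) ∂ℙ) * v t := by
  rw [← integral_mul_const, ← integral_mul_const]
  refine integral_mono ((integrable_marginal ℙ hXm hanti hpos t d).mul_const _)
    ((integrable_marginal ℙ hXm hanti hpos t' d).mul_const _) fun ω => ?_
  have := monotone_marginal_ratio hv hpos hA (le_max_right (d - X ω) 0) htt
  exact (div_le_div_iff₀ (hpos _) (hpos _)).mp this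

/-- A strictly increasing distribution function on `[0, M]` charges `{X < d}` for `d ∈ (0, M]`. -/
lemma measure_lt_pos_of_strictMonoOn (ℙ : Measure Ω) {X : Ω → ℝ} {M d : ℝ}
    (hmono : StrictMonoOn (distFn ℙ X) (Icc 0 M)) (hd : 0 < d) (hdM : d ≤ M) :
    0 < ℙ {ω | X ω < d} := by
  have h := hmono (⟨le_rfl, by linarith⟩ : (0 : ℝ) ∈ Icc 0 M)
    (⟨by linarith, by linarith⟩ : d / 2 ∈ Icc 0 M) (by linarith)
  have h0 : 0 < (ℙ {ω | X ω ≤ d / 2}).toReal := ENNReal.toReal_nonneg.trans_lt h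
  refine (ENNReal.toReal_pos_iff.mp h0).1.trans_le (measure_mono fun ω hω => ?_)
  have : X ω ≤ d / 2 := hω
  exact lt_of_le_of_lt this (by linarith)

/-- In the interior regime, the optimal pair satisfies the premium constraint and the first-order
condition, and the loss stays below the deductible with positive probability. -/
lemma OptPair.interior {ℙ : Measure Ω} [IsProbabilityMeasure ℙ] {X S : Ω → ℝ}
    (hX0 : ∀ ω, 0 ≤ X ω) {η w M : ℝ} (hη : 0 < η) {v : ℝ → ℝ} (hpos : ∀ x, 0 < v x)
    (hmono : StrictMonoOn (distFn ℙ X) (Icc 0 M)) {dfun : ℝ → ℝ} (hd : DFun ℙ η X S M dfun)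
    {a d : ℝ} (hp : OptPair ℙ η X S v w M dfun a d) (hthr : η < thr ℙ X v w M) :
    0 < a ∧ gA ℙ η X S a d = 0 ∧ 0 < ℙ {ω | X ω < d} ∧
      (1 + η) * ∫ ω, v (w - a - d + max (d - X ω) 0) ∂ℙ = v (w - a - d) := by
  obtain ⟨ha, hF, rfl⟩ := hp.2 hthr
  obtain ⟨hmem, hg⟩ := hd a ⟨ha.1.le, ha.2.le⟩
  have hη1 : (1 + η) ≠ 0 := by linarith
  have hF' : (1 + η) * ∫ ω, v (w - a - dfun a + max (dfun a - X ω) 0) ∂ℙ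
      = v (w - a - dfun a) := by
    have e : ∀ ω, w - a - dfun a + max (dfun a - X ω) 0 = w - min (X ω) (dfun a) - a := by
      intro ω
      grind
    simp_rw [e]
    rw [hF, mul_div_cancel₀ _ hη1, sub_right_comm]
  refine ⟨ha.1, hg, measure_lt_pos_of_strictMonoOn ℙ hmono ?_ hmem.2, hF'⟩
  refine lt_of_le_of_ne hmem.1 fun h0 => ?_
  rw [← h0] at hF'
  have e : ∀ ω, max (0 - X ω) 0 = 0 := fun ω => max_eq_right (by linarith [hX0 ω])
  simp only [e, add_zero, integral_const, probReal_univ, one_smul] at hF'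
  nlinarith [hpos (w - a - 0)]

/-- comparative statics in the seller's background risk. If `S₁ ≤ S₂` a.s.
(each satisfying Assumption A) and `η > 0`, then `a₁* ≤ a₂*` and `a₁* + d₁* ≤ a₂* + d₂*`;
under DARA, `d₁* ≥ d₂*`. -/
theorem stmt12
    (ℙ : Measure Ω) [IsProbabilityMeasure ℙ]
    (X S₁ S₂ : Ω → ℝ) (hXm : Measurable X) (hS₁m : Measurable S₁) (hS₂m : Measurable S₂)
    (hX0 : ∀ ω, 0 ≤ X ω) (M : ℝ) (hM : essSup X ℙ = M) (hM0 : 0 < M)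
    (η : ℝ) (hη : 0 < η) (w : ℝ)
    (u u' u'' : ℝ → ℝ)
    (hu' : ∀ x, HasDerivAt u (u' x) x) (hu'' : ∀ x, HasDerivAt u' (u'' x) x)
    (hu'pos : ∀ x, 0 < u' x) (hu''neg : ∀ x, u'' x < 0)
    (hS12 : ∀ᵐ ω ∂ℙ, S₁ ω ≤ S₂ ω)
    (hA₁ : AssumpA ℙ X S₁ M) (hA₂ : AssumpA ℙ X S₂ M)
    (dfun₁ dfun₂ : ℝ → ℝ)
    (hd₁ : DFun ℙ η X S₁ M dfun₁) (hd₂ : DFun ℙ η X S₂ M dfun₂)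
    (a₁ d₁ a₂ d₂ : ℝ)
    (hp₁ : OptPair ℙ η X S₁ u' w M dfun₁ a₁ d₁)
    (hp₂ : OptPair ℙ η X S₂ u' w M dfun₂ a₂ d₂) :
    a₁ ≤ a₂ ∧ a₁ + d₁ ≤ a₂ + d₂ ∧
      (Antitone (fun x => -u'' x / u' x) → d₂ ≤ d₁) := by
  rcases le_or_gt (thr ℙ X u' w M) η with hthr | hthr
  · obtain ⟨rfl, rfl⟩ := hp₁.1 hthr
    obtain ⟨rfl, rfl⟩ := hp₂.1 hthr
    exact ⟨le_rfl, le_rfl, fun _ => le_rfl⟩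
  have hanti : StrictAnti u' :=
    strictAnti_of_deriv_neg fun x => by rw [(hu'' x).deriv]; exact hu''neg x
  have hXM := ae_le_of_essSup_pos ℙ X hM hM0
  obtain ⟨hS₁, -, -, hmono, -⟩ := hA₁
  have hS₂ := hA₂.1
  obtain ⟨ha₁, hg₁, hP₁, hF₁⟩ := hp₁.interior hX0 hη hu'pos hmono hd₁ hthr
  obtain ⟨ha₂, hg₂, hP₂, hF₂⟩ := hp₂.interior hX0 hη hu'pos hmono hd₂ hthr
  have hle : a₁ ≤ a₂ := by
    by_contra! h
    have hc := firstOrder_add_lt_of_lt ℙ hXm hanti hu'pos hη hP₂ hP₁ hF₂ hF₁ h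
    have hp := exceedance_lt_of_firstOrder ℙ hXm hanti.antitone hu'pos hη hP₁ hF₁
    have h1 := gA_lt_of_lt ℙ hXm hS₂m hX0 hXM hS₂ hη ha₂.le h hc.le hp
    have h2 := gA_mono_risk ℙ hXm hS₁m hS₂m hX0 hXM hS₁ hS₂ hS12 hη ha₁.le d₁
    linarith
  have hc : a₁ + d₁ ≤ a₂ + d₂ := by
    rcases hle.eq_or_lt with rfl | h
    · by_contra! hlt
      exact (firstOrder_lt_of_lt ℙ hXm hanti hu'pos hη hP₂ hF₂ (by linarith : d₂ < d₁)).ne hF₁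
    · exact (firstOrder_add_lt_of_lt ℙ hXm hanti hu'pos hη hP₁ hP₂ hF₁ hF₂ h).le
  refine ⟨hle, hc, fun hA => ?_⟩
  by_contra! hlt
  have h1 := integral_marginal_lt ℙ hXm hanti hu'pos (w - a₂ - d₂) hlt hP₂
  have h2 := integral_marginal_mul_le ℙ hXm hu'' hanti.antitone hu'pos hA
    (by linarith : w - a₂ - d₂ ≤ w - a₁ - d₁) d₁
  rw [← hF₁, ← hF₂] at h2
  have hI : 0 < ∫ ω, u' (w - a₁ - d₁ + max (d₁ - X ω) 0) ∂ℙ :=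
    pos_of_mul_pos_right (hF₁ ▸ hu'pos _) (by linarith : 0 ≤ 1 + η)
  have h3 := mul_lt_mul_of_pos_right h1 (mul_pos (by linarith : 0 < 1 + η) hI)
  linarith
end
end
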